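/- Let c be a character and let w⊢ and w⊣ be matches with c_{w⊢} = c_{w⊣} = c, i_{w⊢} = i_{w⊣}, and j_{w⊢} ≤ j_{w⊣}. Then there exists a suff-match v with i_v = i_{w⊢} and j_{w⊢} ≤ j_v ≤ j_{w⊣} if and only if there exists a suff-match v' with c_{v'} = c, d̂_{w⊢} ≤ d̂_{v'} ≤ d̂_{w⊣}, and î_{w⊢} ≤ î_{v'}. -/

import Mathlib

open scoped Classical

namespace MCSPaper

variable {α : Type*}

/-- `Z` is a common subsequence of `X` and `Y` (i.e. `X` and `Y` share `Z`). -/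
def Shares (X Y Z : List α) : Prop := Z.Sublist X ∧ Z.Sublist Y

/-- `Z` is a maximal common subsequence of `X` and `Y`: it is a common
subsequence and no single-character insertion yields a common subsequence. -/
def IsMCS (X Y Z : List α) : Prop :=
  Shares X Y Z ∧
    ∀ k, k ≤ Z.length → ∀ c : α, ¬ Shares X Y (Z.take k ++ c :: Z.drop k)

/-- `w = (i, j)` is a match: `1 ≤ i ≤ |X|`, `1 ≤ j ≤ |Y|`, `X[i] = Y[j]`
(1-based indexing). -/
def IsMatch (X Y : List α) (w : ℕ × ℕ) : Prop :=
  1 ≤ w.1 ∧ w.1 ≤ X.length ∧ 1 ≤ w.2 ∧ w.2 ≤ Y.length ∧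
    ∃ c : α, X[w.1 - 1]? = some c ∧ Y[w.2 - 1]? = some c

/-- `c_w = c`, i.e. `X[i_w] = Y[j_w] = c` (1-based indexing). -/
def MatchChar (X Y : List α) (w : ℕ × ℕ) (c : α) : Prop :=
  X[w.1 - 1]? = some c ∧ Y[w.2 - 1]? = some c

/-- `pref(Z)`: componentwise least 1-based indices `(i, j)` such that
`X[1..i]` and `Y[1..j]` contain `Z` as a subsequence; `pref(ε) = (0,0)`. -/
noncomputable def prefPair (X Y Z : List α) : ℕ × ℕ :=
  (sInf {i | Z.Sublist (X.take i)}, sInf {j | Z.Sublist (Y.take j)})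

/-- `suff(Z)`: componentwise greatest 1-based indices `(i, j)` such that
`X[i..|X|]` and `Y[j..|Y|]` contain `Z` as a subsequence;
`suff(ε) = (|X|+1, |Y|+1)`. -/
noncomputable def suffPair (X Y Z : List α) : ℕ × ℕ :=
  (sSup {i | i ≤ X.length + 1 ∧ Z.Sublist (X.drop (i - 1))},
   sSup {j | j ≤ Y.length + 1 ∧ Z.Sublist (Y.drop (j - 1))})

/-- `u < v` componentwise strictly. -/
def pLt (u v : ℕ × ℕ) : Prop := u.1 < v.1 ∧ u.2 < v.2

/-- `u ≤ v` componentwise. -/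
def pLe (u v : ℕ × ℕ) : Prop := u.1 ≤ v.1 ∧ u.2 ≤ v.2

/-- `u ⪇ v`: `u ≤ v` componentwise and `u ≠ v`. -/
def pLneq (u v : ℕ × ℕ) : Prop := pLe u v ∧ u ≠ v

/-- `u ≺ v`: `u < v` and there is no match `w` with `u < w < v`. -/
def pPrec (X Y : List α) (u v : ℕ × ℕ) : Prop :=
  pLt u v ∧ ¬ ∃ w, IsMatch X Y w ∧ pLt u w ∧ pLt w v

/-- `w` is a suff-match: `w = suff(Z)` for some nonempty shared `Z`. -/
def IsSuffMatch (X Y : List α) (w : ℕ × ℕ) : Prop :=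
  ∃ Z : List α, Z ≠ [] ∧ Shares X Y Z ∧ suffPair X Y Z = w

/-- `w` is a pref-match: `w = pref(Z)` for some nonempty shared `Z`. -/
def IsPrefMatch (X Y : List α) (w : ℕ × ℕ) : Prop :=
  ∃ Z : List α, Z ≠ [] ∧ Shares X Y Z ∧ prefPair X Y Z = w

/-- `next_W(c, h)`: least `h'` with `h < h' ≤ |W|` and `W[h'] = c`,
or `|W| + 1` if none (1-based). -/
noncomputable def nextIdx (W : List α) (c : α) (h : ℕ) : ℕ :=
  sInf ({h' | h < h' ∧ W[h' - 1]? = some c} ∪ {W.length + 1})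

/-- `prev_W(c, h)`: greatest `h'` with `1 ≤ h' < h` and `W[h'] = c`,
or `0` if none (1-based). -/
noncomputable def prevIdx (W : List α) (c : α) (h : ℕ) : ℕ :=
  sSup {h' | 1 ≤ h' ∧ h' < h ∧ W[h' - 1]? = some c}

/-- `next(c, w) = (next_X(c, i_w), next_Y(c, j_w))`. -/
noncomputable def nextPair (X Y : List α) (c : α) (w : ℕ × ℕ) : ℕ × ℕ :=
  (nextIdx X c w.1, nextIdx Y c w.2)

/-- `prev(c, w) = (prev_X(c, i_w), prev_Y(c, j_w))`. -/
noncomputable def prevPair (X Y : List α) (c : α) (w : ℕ × ℕ) : ℕ × ℕ :=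
  (prevIdx X c w.1, prevIdx Y c w.2)

/-- `Z'` is a prefix of some MCS of `X` and `Y`. -/
def IsMCSPrefix (X Y Z' : List α) : Prop :=
  ∃ M, IsMCS X Y M ∧ Z' <+: M

/-- `c` is `Z'`-extensible: `Z' ∘ c` is an MCS-prefix. -/
def Extensible (X Y Z' : List α) (c : α) : Prop :=
  IsMCSPrefix X Y (Z' ++ [c])

/-- `Zs` is a single-character insertion derivative of `Z` (shared by `X`, `Y`). -/
def IsDeriv (X Y Z Zs : List α) : Prop :=
  ∃ k, k ≤ Z.length ∧ ∃ c : α, Zs = Z.take k ++ c :: Z.drop k ∧ Shares X Y Zs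

/-- `safe(Z')` as in Conte et al. -/
noncomputable def safePair (X Y Z' : List α) : ℕ × ℕ :=
  (sInf ({i | ∃ Zs, IsDeriv X Y Z' Zs ∧
      prefPair X Y Zs = (i, (prefPair X Y Z').2)} ∪ {X.length + 1}),
   sInf ({j | ∃ Zs, IsDeriv X Y Z' Zs ∧
      prefPair X Y Zs = ((prefPair X Y Z').1, j)} ∪ {Y.length + 1}))

/-- `v` is a `c`-witness of `Z'`-extensibility. -/
def IsCWitness (X Y Z' : List α) (c : α) (v : ℕ × ℕ) : Prop :=
  IsSuffMatch X Y v ∧ pPrec X Y (prefPair X Y Z') v ∧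
    pLe v (safePair X Y Z') ∧ MatchChar X Y v c

/-- `v` is a witness of `Z'`-extensibility. -/
def IsWitness (X Y Z' : List α) (v : ℕ × ℕ) : Prop :=
  ∃ c, IsCWitness X Y Z' c v

/-- `v` is a prominent witness of `Z'`-extensibility. -/
def Prominent (X Y Z' : List α) (v : ℕ × ℕ) : Prop :=
  IsWitness X Y Z' v ∧ ¬ ∃ v', IsWitness X Y Z' v' ∧ pLneq v' v

/-- `Suff_i[j]`: least `i'` with `i ≤ i' ≤ |X|` such that `(i', j)` is a
suff-match, or `|X| + 1` if none. -/
noncomputable def SuffSeq (X Y : List α) (i j : ℕ) : ℕ :=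
  sInf ({i' | i ≤ i' ∧ i' ≤ X.length ∧ IsSuffMatch X Y (i', j)} ∪ {X.length + 1})

/-- `î`: number of indices `i'` with `1 ≤ i' ≤ i` and `X[i'] = c`. -/
def hatI [DecidableEq α] (X : List α) (c : α) (i : ℕ) : ℕ :=
  (X.take i).count c

/-- `ĵ`: number of indices `j'` with `1 ≤ j' ≤ j` and `Y[j'] = c`. -/
def hatJ [DecidableEq α] (Y : List α) (c : α) (j : ℕ) : ℕ :=
  (Y.take j).count c

/-- Sentinel assumptions: `Σ = {1, …, σ}`, `X[1] = Y[1] = 1`,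
`X[|X|] = Y[|Y|] = σ`, and the inner characters lie in `{2, …, σ−1}`. -/
def Sentinel (X Y : List ℕ) (σ : ℕ) : Prop :=
  X ≠ [] ∧ Y ≠ [] ∧ X.head? = some 1 ∧ Y.head? = some 1 ∧
    X.getLast? = some σ ∧ Y.getLast? = some σ ∧
    (∀ c ∈ (X.drop 1).dropLast, 2 ≤ c ∧ c ≤ σ - 1) ∧
    (∀ c ∈ (Y.drop 1).dropLast, 2 ≤ c ∧ c ≤ σ - 1)

/-- `i` is the greatest 1-based index such that `W[i..|W|]` contains `Z`. -/
def IsSuffPos (W Z : List α) (i : ℕ) : Prop :=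
  1 ≤ i ∧ Z.Sublist (W.drop (i - 1)) ∧ ¬ Z.Sublist (W.drop i)

theorem IsSuffPos.le_length {W Z : List α} {i : ℕ} (h : IsSuffPos W Z i) : i ≤ W.length := by
  obtain ⟨_, h2, h3⟩ := h
  by_contra! hi
  apply h3
  rw [List.drop_eq_nil_of_le (by omega)] at h2 ⊢
  exact h2

theorem IsSuffPos.sSup_eq {W Z : List α} {i : ℕ} (h : IsSuffPos W Z i) :
    sSup {i | i ≤ W.length + 1 ∧ Z.Sublist (W.drop (i - 1))} = i := by
  have hlen := h.le_length
  obtain ⟨h1, h2, h3⟩ := h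
  refine IsGreatest.csSup_eq ⟨⟨by omega, h2⟩, ?_⟩
  rintro k ⟨-, hk⟩
  by_contra! hik
  exact h3 (hk.trans (List.drop_sublist_drop_left W (by omega)))

theorem exists_isSuffPos {W Z : List α} (hZ : Z ≠ []) (h : Z.Sublist W) :
    ∃ i, IsSuffPos W Z i := by
  have hex : ∃ k, ¬ Z.Sublist (W.drop k) := ⟨W.length, by simpa using hZ⟩
  have hpos : 1 ≤ Nat.find hex := by
    rw [Nat.one_le_iff_ne_zero]
    intro h0
    have := Nat.find_spec hex
    rw [h0] at this
    exact this h
  exact ⟨Nat.find hex, hpos, not_not.1 (Nat.find_min hex (by omega)), Nat.find_spec hex⟩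

theorem IsSuffPos.getElem?_eq {W T : List α} {a : α} {i : ℕ} (h : IsSuffPos W (a :: T) i) :
    W[i - 1]? = some a := by
  have hlen := h.le_length
  obtain ⟨h1, h2, h3⟩ := h
  have hlt : i - 1 < W.length := by omega
  rw [List.drop_eq_getElem_cons hlt, Nat.sub_add_cancel h1] at h2
  rw [List.getElem?_eq_getElem hlt]
  cases h2 with
  | cons _ h => exact absurd h h3
  | cons_cons _ h => rfl

theorem isSuffMatch_iff {X Y : List α} {v : ℕ × ℕ} :
    IsSuffMatch X Y v ↔
      ∃ a T, IsSuffPos X (a :: T) v.1 ∧ IsSuffPos Y (a :: T) v.2 := by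
  constructor
  · rintro ⟨Z, hZ, ⟨hX, hY⟩, rfl⟩
    obtain ⟨i, hi⟩ := exists_isSuffPos hZ hX
    obtain ⟨j, hj⟩ := exists_isSuffPos hZ hY
    obtain ⟨a, T, rfl⟩ := List.exists_cons_of_ne_nil hZ
    refine ⟨a, T, ?_, ?_⟩
    · rwa [suffPair, hi.sSup_eq]
    · rwa [suffPair, hj.sSup_eq]
  · rintro ⟨a, T, hX, hY⟩
    exact ⟨a :: T, by simp, ⟨hX.2.1.trans (List.drop_sublist _ _),
      hY.2.1.trans (List.drop_sublist _ _)⟩, Prod.ext hX.sSup_eq hY.sSup_eq⟩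

theorem drop_eq_drop_take_append (W : List α) {j i : ℕ} (h : j ≤ i) (hi : i ≤ W.length) :
    W.drop j = (W.take i).drop j ++ W.drop i := by
  conv_lhs => rw [← List.take_append_drop i W]
  rw [List.drop_append_of_le_length (by simp; omega)]

section Count

variable [DecidableEq α]

theorem count_take_mono (W : List α) (c : α) {j k : ℕ} (h : j ≤ k) :
    (W.take j).count c ≤ (W.take k).count c :=
  (List.take_sublist_take_left h).count_le c

theorem count_take_of_getElem? {W : List α} {c : α} {k : ℕ} (hk : 1 ≤ k)
    (h : W[k - 1]? = some c) :
    (W.take k).count c = (W.take (k - 1)).count c + 1 := by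
  obtain ⟨m, rfl⟩ : ∃ m, k = m + 1 := ⟨k - 1, by omega⟩
  simp only [Nat.add_sub_cancel] at h ⊢
  simp [List.take_add_one, h]

theorem count_take_lt {W : List α} {c : α} {j k : ℕ} (hjk : j < k)
    (h : W[k - 1]? = some c) : (W.take j).count c < (W.take k).count c := by
  have h1 := count_take_of_getElem? (by omega) h
  have h2 := count_take_mono W c (show j ≤ k - 1 by omega)
  omega

theorem exists_count_take_eq {W : List α} {c : α} {m i : ℕ} (hm : 1 ≤ m)
    (h : m ≤ (W.take i).count c) :
    ∃ j, 1 ≤ j ∧ j ≤ i ∧ W[j - 1]? = some c ∧ (W.take j).count c = m := by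
  induction i with
  | zero => simp at h; omega
  | succ i ih =>
    by_cases hi : m ≤ (W.take i).count c
    · obtain ⟨j, h1, h2, h3⟩ := ih hi
      exact ⟨j, h1, by omega, h3⟩
    · by_cases hc : W[i]? = some c
      · have := count_take_of_getElem? (W := W) (c := c) (k := i + 1) (by omega) (by simpa using hc)
        simp only [Nat.add_sub_cancel] at this
        exact ⟨i + 1, by omega, le_rfl, by simpa using hc, by omega⟩
      · exfalso
        apply hi
        rw [List.take_add_one, List.count_append] at h
        cases hw : W[i]? with
        | none => simpa [hw] using h
        | some b =>
          have : b ≠ c := by rintro rfl; exact hc hw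
          simpa [hw, this] using h

theorem count_drop_take (W : List α) (c : α) {j i : ℕ} (h : j ≤ i) :
    (W.take j).count c + ((W.take i).drop j).count c = (W.take i).count c := by
  conv_rhs => rw [← List.take_append_drop j (W.take i)]
  rw [List.count_append, List.take_take, min_eq_left h]

/-- Prepending copies of the first character of `Z` moves the greatest starting position back by
as many occurrences of that character. -/
theorem IsSuffPos.replicate_append {W T : List α} {a : α} {i j n : ℕ}
    (h : IsSuffPos W (a :: T) i) (hj : 1 ≤ j) (hji : j ≤ i) (ha : W[j - 1]? = some a)
    (hn : (W.take i).count a = (W.take j).count a + n) :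
    IsSuffPos W (List.replicate n a ++ a :: T) j := by
  have hlen := h.le_length
  have hia := h.getElem?_eq
  obtain ⟨h1, h2, h3⟩ := h
  refine ⟨hj, ?_, ?_⟩
  · rw [drop_eq_drop_take_append W (show j - 1 ≤ i - 1 by omega) (by omega)]
    refine List.Sublist.append ?_ h2
    rw [List.replicate_sublist_iff]
    have e1 := count_drop_take W a (show j - 1 ≤ i - 1 by omega)
    have e2 := count_take_of_getElem? hj ha
    have e3 := count_take_of_getElem? h1 hia
    omega
  · rw [drop_eq_drop_take_append W hji hlen]
    intro hs
    obtain ⟨r₁, r₂, hr, hr₁, hr₂⟩ := List.sublist_append_iff.1 hs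
    have e1 := count_drop_take W a hji
    have e2 := hr₁.count_le a
    rcases List.append_eq_append_iff.1 hr with ⟨u, hu, hu'⟩ | ⟨u, hu, hu'⟩
    · cases u with
      | nil => exact h3 (by simp at hu'; rw [hu']; exact hr₂)
      | cons b u =>
        obtain ⟨rfl, -⟩ := by simpa using hu'
        rw [hu] at e2
        simp at e2
        omega
    · rw [hu'] at hr₂
      exact h3 ((List.sublist_append_right _ _).trans hr₂)

end Count

theorem statement17 {α : Type*} [DecidableEq α] (X Y : List α)
    (hX : X ≠ []) (hY : Y ≠ [])
    (c : α) (wl wr : ℕ × ℕ) (hwl : IsMatch X Y wl) (hwr : IsMatch X Y wr)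
    (hcl : MatchChar X Y wl c) (hcr : MatchChar X Y wr c)
    (hi : wl.1 = wr.1) (hj : wl.2 ≤ wr.2) :
    (∃ v, IsSuffMatch X Y v ∧ v.1 = wl.1 ∧ wl.2 ≤ v.2 ∧ v.2 ≤ wr.2) ↔
      (∃ v', IsSuffMatch X Y v' ∧ MatchChar X Y v' c ∧
        ((hatJ Y c wl.2 : ℤ) - hatI X c wl.1 ≤
          (hatJ Y c v'.2 : ℤ) - hatI X c v'.1) ∧
        ((hatJ Y c v'.2 : ℤ) - hatI X c v'.1 ≤
          (hatJ Y c wr.2 : ℤ) - hatI X c wr.1) ∧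
        hatI X c wl.1 ≤ hatI X c v'.1) := by
  simp only [hatI, hatJ]
  constructor
  · rintro ⟨v, hv, hvi, hl, hr⟩
    obtain ⟨a, T, hvX, hvY⟩ := isSuffMatch_iff.1 hv
    have hac : a = c := by
      have := hvX.getElem?_eq
      rw [hvi, hcl.1] at this
      exact (Option.some.inj this).symm
    subst hac
    have h1 := count_take_mono Y a hl
    have h2 := count_take_mono Y a hr
    refine ⟨v, hv, ⟨hvX.getElem?_eq, hvY.getElem?_eq⟩, ?_, ?_, by rw [hvi]⟩
    · rw [hvi]; omega
    · rw [hvi, ← hi]; omega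
  · rintro ⟨v, hv, hvc, hl, hr, hle⟩
    obtain ⟨a, T, hvX, hvY⟩ := isSuffMatch_iff.1 hv
    have hac : a = c := by
      have := hvX.getElem?_eq
      rw [hvc.1] at this
      exact (Option.some.inj this).symm
    subst hac
    obtain ⟨n, hn⟩ := Nat.exists_eq_add_of_le hle
    have hY1 := count_take_of_getElem? hwl.2.2.1 hcl.2
    rw [← hi] at hr
    obtain ⟨j, hj1, hj2, hj3, hj4⟩ := exists_count_take_eq (W := Y) (c := a) (i := v.2)
      (m := (Y.take v.2).count a - n) (by omega) (by omega)
    have hiv : wl.1 ≤ v.1 := by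
      by_contra! hlt
      have := count_take_lt hlt hcl.1
      omega
    have hX' := hvX.replicate_append hwl.1 hiv hcl.1 hn
    have hY' := hvY.replicate_append (n := n) hj1 hj2 hj3 (by omega)
    refine ⟨(wl.1, j), isSuffMatch_iff.2 ?_, rfl, ?_, ?_⟩
    · refine ⟨a, List.replicate n a ++ T, ?_, ?_⟩
      · rwa [← List.cons_append, ← List.replicate_succ, List.replicate_succ', List.append_assoc]
      · rwa [← List.cons_append, ← List.replicate_succ, List.replicate_succ', List.append_assoc]
    · show wl.2 ≤ j
      by_contra! hlt
      have := count_take_lt hlt hcl.2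
      omega
    · show j ≤ wr.2
      by_contra! hlt
      have := count_take_lt hlt hj3
      omega

end MCSPaper
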